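/- Let A be an n-by-n reciprocal matrix with n ≥ 2, and let i ∈ {1,…,n}. If E(A(i)) is PWL connected, then E(A;i) is PWL connected. -/

import Mathlib

def PosVec {ι : Type*} (w : ι → ℝ) : Prop := ∀ i, 0 < w i

def IsReciprocal {ι : Type*} (A : Matrix ι ι ℝ) : Prop :=
  (∀ i j, 0 < A i j) ∧ ∀ i j, A j i = 1 / A i j

def IsEfficient {ι : Type*} (A : Matrix ι ι ℝ) (w : ι → ℝ) : Prop :=
  PosVec w ∧ ∀ v : ι → ℝ, PosVec v →
    (∀ i j, |A i j - v i / v j| ≤ |A i j - w i / w j|) →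
    ∃ c : ℝ, 0 < c ∧ v = c • w

/-- The principal submatrix `A(k)` of `A` obtained by deleting row and column `k`. -/
def delMat {n : ℕ} (A : Matrix (Fin n) (Fin n) ℝ) (k : Fin n) :
    Matrix {i : Fin n // i ≠ k} {i : Fin n // i ≠ k} ℝ :=
  Matrix.of fun a b => A a.1 b.1

/-- The vector `w(k)` obtained from `w` by deleting the `k`-th entry. -/
def delVec {n : ℕ} (w : Fin n → ℝ) (k : Fin n) : {i : Fin n // i ≠ k} → ℝ :=
  fun a => w a.1

/-- `E(A)`, the set of efficient vectors for `A`. -/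
def Eset {ι : Type*} (A : Matrix ι ι ℝ) : Set (ι → ℝ) := {w | IsEfficient A w}

/-- `E(A; i)`, the set of efficient vectors `w` for `A` such that `w(i)` is efficient
for `A(i)`. -/
def EsetSub {n : ℕ} (A : Matrix (Fin n) (Fin n) ℝ) (i : Fin n) : Set (Fin n → ℝ) :=
  {w | IsEfficient A w ∧ IsEfficient (delMat A i) (delVec w i)}

/-- A set `S` of vectors is PWL (piecewise linearly) connected if any two of its points are
joined by a finite polygonal path whose vertices and segments all lie in `S`. -/
def PWLConnected {ι : Type*} (S : Set (ι → ℝ)) : Prop :=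
  ∀ x ∈ S, ∀ y ∈ S, ∃ (s : ℕ) (u : ℕ → ι → ℝ), u 0 = x ∧ u s = y ∧
    (∀ i ≤ s, u i ∈ S) ∧
    ∀ i < s, ∀ t : ℝ, 0 < t → t < 1 → (t • u i + (1 - t) • u (i + 1)) ∈ S

def FibC {n : ℕ} (A : Matrix (Fin n) (Fin n) ℝ) (i : Fin n) (w : Fin n → ℝ) : Prop :=
  (∃ j, j ≠ i ∧ A i j * w j ≤ w i) ∧ (∃ j, j ≠ i ∧ w i ≤ A i j * w j)

lemma mem_of_fib {n : ℕ} (A : Matrix (Fin n) (Fin n) ℝ)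
    (hA : IsReciprocal A) (i : Fin n) (w : Fin n → ℝ)
    (hw : IsEfficient (delMat A i) (delVec w i)) (hc : FibC A i w) : w ∈ EsetSub A i := by
  obtain ⟨⟨j, hj, hjw⟩, ⟨k, hk, hkw⟩⟩ := hc
  have hpos : ∀ l, l ≠ i → 0 < w l := fun l hl => hw.1 ⟨l, hl⟩
  have hwi : 0 < w i := lt_of_lt_of_le (mul_pos (hA.1 i j) (hpos j hj)) hjw
  refine ⟨⟨fun l => ?_, fun v hv hle => ?_⟩, hw⟩
  · by_cases hl : l = i
    · rw [hl]; exact hwi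
    · exact hpos l hl
  obtain ⟨c, hc, hvc⟩ := hw.2 (delVec v i) (fun l => hv l.1) (fun a b => hle a.1 b.1)
  have hvl : ∀ l, l ≠ i → v l = c * w l := fun l hl => congrFun hvc ⟨l, hl⟩
  refine ⟨c, hc, ?_⟩
  have h1 : v i ≤ c * w i := by
    have h0 := hle i j
    have hwj := hpos j hj
    have e : A i j ≤ w i / w j := by rwa [le_div_iff₀ hwj]
    rw [abs_of_nonpos (by linarith : A i j - w i / w j ≤ 0), hvl j hj] at h0
    have h2 := (abs_le.1 h0).1
    have h3 : v i / (c * w j) ≤ w i / w j := by linarith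
    rw [div_le_div_iff₀ (by positivity) hwj] at h3
    have : v i * w j ≤ (c * w i) * w j := by linarith
    exact le_of_mul_le_mul_right this hwj
  have h1' : c * w i ≤ v i := by
    have h0 := hle i k
    have hwj := hpos k hk
    have e : w i / w k ≤ A i k := by rwa [div_le_iff₀ hwj]
    rw [abs_of_nonneg (by linarith : 0 ≤ A i k - w i / w k), hvl k hk] at h0
    have h2 := (abs_le.1 h0).2
    have h3 : w i / w k ≤ v i / (c * w k) := by linarith
    rw [div_le_div_iff₀ hwj (by positivity)] at h3
    have : (c * w i) * w k ≤ v i * w k := by linarith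
    exact le_of_mul_le_mul_right this hwj
  funext l
  by_cases hl : l = i
  · rw [hl]; exact le_antisymm h1 h1'
  · exact hvl l hl

/-- Moving the `i`-th entry to a value closer to all the targets contradicts efficiency. -/
lemma no_improve {n : ℕ} (A : Matrix (Fin n) (Fin n) ℝ) (i j : Fin n) (hj : j ≠ i)
    (w : Fin n → ℝ) (hw : IsEfficient A w) (b : ℝ) (hb : 0 < b) (hne : b ≠ w i)
    (h1 : ∀ l, l ≠ i → |A i l - b / w l| ≤ |A i l - w i / w l|)
    (h2 : ∀ l, l ≠ i → |A l i - w l / b| ≤ |A l i - w l / w i|) : False := by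
  obtain ⟨c, hc, hv⟩ := hw.2 (Function.update w i b) (fun l => by
    by_cases hl : l = i
    · subst hl; simpa using hb
    · simpa [hl] using hw.1 l) (fun p q => by
    by_cases hp : p = i
    · by_cases hq : q = i
      · subst hp; subst hq
        simp [hb.ne', (hw.1 q).ne']
      · subst hp; simpa [hq] using h1 q hq
    · by_cases hq : q = i
      · subst hq; simpa [hp] using h2 p hp
      · simp [hp, hq])
  have e1 := congrFun hv j
  have e2 := congrFun hv i
  simp [hj] at e1 e2
  have := (hw.1 j).ne'
  have hc1 : c = 1 := by
    have e3 : c * w j = 1 * w j := by linarith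
    exact mul_right_cancel₀ this e3
  rw [hc1, one_mul] at e2
  exact hne e2

lemma fib_of_mem {n : ℕ} (A : Matrix (Fin n) (Fin n) ℝ)
    (hA : IsReciprocal A) (i j : Fin n) (hj : j ≠ i) (w : Fin n → ℝ)
    (hw : IsEfficient A w) : FibC A i w := by
  have hwp := hw.1
  have hne : (Finset.univ.filter (fun l => l ≠ i)).Nonempty := ⟨j, by simpa using hj⟩
  constructor
  · by_contra! hcon
    obtain ⟨m, hm, hmin⟩ := Finset.exists_min_image _ (fun l => A i l * w l) hne
    simp only [Finset.mem_filter, Finset.mem_univ, true_and] at hm hmin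
    have hb : 0 < A i m * w m := mul_pos (hA.1 i m) (hwp m)
    have hwi := hwp i
    refine no_improve A i j hj w hw (A i m * w m) hb (hcon m hm).ne' ?_ ?_
    · intro l hl
      have hwl := hwp l
      have e1 : A i m * w m / w l ≤ A i l := by rw [div_le_iff₀ hwl]; exact hmin l hl
      have e2 : w i / w l ≤ A i m * w m / w l := by
        have := (hcon m hm).le
        gcongr
      rw [abs_of_nonneg (by linarith), abs_of_nonneg (by linarith)]; linarith
    · intro l hl
      have hwl := hwp l
      have hal := hA.1 i l
      have e1 : A l i ≤ w l / (A i m * w m) := by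
        rw [hA.2 i l, div_le_div_iff₀ hal hb]; have := hmin l hl; linarith
      have e2 : w l / (A i m * w m) ≤ w l / w i := by
        have := (hcon m hm).le
        gcongr
      rw [abs_of_nonpos (by linarith), abs_of_nonpos (by linarith)]; linarith
  · by_contra! hcon
    obtain ⟨m, hm, hmax⟩ := Finset.exists_max_image _ (fun l => A i l * w l) hne
    simp only [Finset.mem_filter, Finset.mem_univ, true_and] at hm hmax
    have hb : 0 < A i m * w m := mul_pos (hA.1 i m) (hwp m)
    have hwi := hwp i
    refine no_improve A i j hj w hw (A i m * w m) hb (hcon m hm).ne ?_ ?_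
    · intro l hl
      have hwl := hwp l
      have e1 : A i l ≤ A i m * w m / w l := by rw [le_div_iff₀ hwl]; exact hmax l hl
      have e2 : A i m * w m / w l ≤ w i / w l := by
        have := (hcon m hm).le
        gcongr
      rw [abs_of_nonpos (by linarith), abs_of_nonpos (by linarith)]; linarith
    · intro l hl
      have hwl := hwp l
      have hal := hA.1 i l
      have e1 : w l / (A i m * w m) ≤ A l i := by
        rw [hA.2 i l, div_le_div_iff₀ hb hal]; have := hmax l hl; linarith
      have e2 : w l / w i ≤ w l / (A i m * w m) := by
        have := (hcon m hm).le
        gcongr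
      rw [abs_of_nonneg (by linarith), abs_of_nonneg (by linarith)]; linarith

noncomputable def liftV {n : ℕ} (A : Matrix (Fin n) (Fin n) ℝ) (i j : Fin n) (hj : j ≠ i)
    (u : {l : Fin n // l ≠ i} → ℝ) : Fin n → ℝ :=
  fun k => if h : k = i then A i j * u ⟨j, hj⟩ else u ⟨k, h⟩

lemma liftV_i {n : ℕ} (A : Matrix (Fin n) (Fin n) ℝ) (i j : Fin n) (hj : j ≠ i)
    (u : {l : Fin n // l ≠ i} → ℝ) : liftV A i j hj u i = A i j * u ⟨j, hj⟩ := by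
  simp [liftV]

lemma liftV_ne {n : ℕ} (A : Matrix (Fin n) (Fin n) ℝ) (i j : Fin n) (hj : j ≠ i)
    (u : {l : Fin n // l ≠ i} → ℝ) (k : Fin n) (hk : k ≠ i) :
    liftV A i j hj u k = u ⟨k, hk⟩ := by
  simp [liftV, hk]

lemma del_liftV {n : ℕ} (A : Matrix (Fin n) (Fin n) ℝ) (i j : Fin n) (hj : j ≠ i)
    (u : {l : Fin n // l ≠ i} → ℝ) : delVec (liftV A i j hj u) i = u := by
  funext k; exact liftV_ne A i j hj u k.1 k.2

lemma liftV_mem {n : ℕ} (A : Matrix (Fin n) (Fin n) ℝ) (hA : IsReciprocal A)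
    (i j : Fin n) (hj : j ≠ i) (u : {l : Fin n // l ≠ i} → ℝ) (hu : u ∈ Eset (delMat A i)) :
    liftV A i j hj u ∈ EsetSub A i := by
  apply mem_of_fib A hA
  · rw [del_liftV]; exact hu
  · constructor <;> exact ⟨j, hj, by rw [liftV_i, liftV_ne A i j hj u j hj]⟩

lemma liftV_comb {n : ℕ} (A : Matrix (Fin n) (Fin n) ℝ)
    (i j : Fin n) (hj : j ≠ i) (u v : {l : Fin n // l ≠ i} → ℝ) (s t : ℝ) :
    s • liftV A i j hj u + t • liftV A i j hj v = liftV A i j hj (s • u + t • v) := by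
  funext k
  by_cases hk : k = i
  · subst hk; simp [liftV]; ring
  · simp [liftV, hk]

lemma seg_mem {n : ℕ} (A : Matrix (Fin n) (Fin n) ℝ) (hA : IsReciprocal A)
    (i j : Fin n) (hj : j ≠ i) (x : Fin n → ℝ) (hx : x ∈ EsetSub A i) (t : ℝ) (h0 : 0 < t)
    (h1 : t < 1) : t • x + (1 - t) • liftV A i j hj (delVec x i) ∈ EsetSub A i := by
  have hz : ∀ k, k ≠ i → (t • x + (1 - t) • liftV A i j hj (delVec x i)) k = x k := by
    intro k hk
    simp [liftV, hk, delVec]; ring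
  have hzi : (t • x + (1 - t) • liftV A i j hj (delVec x i)) i
      = t * x i + (1 - t) * (A i j * x j) := by
    simp [liftV, delVec]
  obtain ⟨⟨a, ha, hax⟩, ⟨b, hb, hbx⟩⟩ := fib_of_mem A hA i j hj x hx.1
  apply mem_of_fib A hA
  · convert hx.2 using 1
    funext k
    exact hz k.1 k.2
  · rcases le_total (x i) (A i j * x j) with hh | hh
    · refine ⟨⟨a, ha, ?_⟩, ⟨j, hj, ?_⟩⟩
      · rw [hz a ha, hzi]; nlinarith
      · rw [hz j hj, hzi]; nlinarith
    · refine ⟨⟨j, hj, ?_⟩, ⟨b, hb, ?_⟩⟩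
      · rw [hz j hj, hzi]; nlinarith
      · rw [hz b hb, hzi]; nlinarith

/-- if `E(A(i))` is PWL connected, then `E(A; i)` is PWL connected. -/
theorem EsetSub_PWLConnected_of_del {n : ℕ} (hn : 2 ≤ n) (A : Matrix (Fin n) (Fin n) ℝ)
    (hA : IsReciprocal A) (i : Fin n) (h : PWLConnected (Eset (delMat A i))) :
    PWLConnected (EsetSub A i) := by
  haveI : Nontrivial (Fin n) := Fin.nontrivial_iff_two_le.2 hn
  obtain ⟨j, hj⟩ := exists_ne i
  intro x hx y hy
  obtain ⟨s, u, hu0, hus, hmem, hseg⟩ := h (delVec x i) hx.2 (delVec y i) hy.2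
  refine ⟨s + 2, fun k => if k = 0 then x else if k ≤ s + 1 then liftV A i j hj (u (k - 1)) else y,
    by simp, by simp, ?_, ?_⟩
  · intro k hk
    by_cases h0 : k = 0
    · simpa [h0] using hx
    by_cases h1 : k ≤ s + 1
    · simpa [h0, h1] using liftV_mem A hA i j hj _ (hmem (k - 1) (by omega))
    · simpa [h0, h1] using hy
  · intro k hk t ht0 ht1
    by_cases h0 : k = 0
    · subst h0
      have := seg_mem A hA i j hj x hx t ht0 ht1
      rw [← hu0] at this
      simpa using this
    obtain ⟨m, rfl⟩ : ∃ m, k = m + 1 := ⟨k - 1, by omega⟩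
    by_cases h1 : m < s
    · have h2 : m ≤ s := h1.le
      have h3 : m + 1 ≤ s := h1
      have := liftV_mem A hA i j hj _ (hseg m h1 t ht0 ht1)
      rw [← liftV_comb] at this
      simpa [h2, h3] using this
    · obtain rfl : m = s := by omega
      have := seg_mem A hA i j hj y hy (1 - t) (by linarith) (by linarith)
      rw [← hus, add_comm, sub_sub_cancel] at this
      simpa using this
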